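/- arXiv:0903.0664 — 7 statements merged into one kernel-verified Lean document; each statement's English description precedes it below -/
import Mathlib

section
/- Let P be a Markov transition kernel on a measurable space (X, B) with invariant probability measure π. Suppose there exist a positive integer n0, a number ε ∈ (0,1], and a probability measure Q on B such that the n0-step kernel satisfies P^{n0}(x, A) ≥ ε Q(A) for all x ∈ X and all A ∈ B (a minorization condition holding on the whole space). Then the chain is uniformly ergodic: for every n ≥ 1, every x ∈ X, and every A ∈ B, |P^n(x, A) − π(A)| ≤ (1 − ε)^{⌊n/n0⌋}, where ⌊·⌋ denotes the greatest integer function. -/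
open MeasureTheory ProbabilityTheory

/-- The `n`-step Markov transition kernel, obtained by iterated composition of `P`. -/
noncomputable def kIter {X : Type*} [MeasurableSpace X] (P : Kernel X X) : ℕ → Kernel X X
  | 0 => Kernel.id
  | n + 1 => (kIter P n) ∘ₖ P

theorem kIter_eq_pow {X : Type*} [MeasurableSpace X] (P : Kernel X X) (n : ℕ) :
    kIter P n = P ^ n := by
  induction n with
  | zero => rfl
  | succ n ih => rw [pow_succ, ← ih]; rfl

instance isMarkovKernel_kIter {X : Type*} [MeasurableSpace X] (P : Kernel X X)
    [IsMarkovKernel P] (n : ℕ) : IsMarkovKernel (kIter P n) := by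
  induction n with
  | zero => exact inferInstanceAs (IsMarkovKernel Kernel.id)
  | succ n ih => exact inferInstanceAs (IsMarkovKernel (kIter P n ∘ₖ P))

theorem kIter_add {X : Type*} [MeasurableSpace X] (P : Kernel X X) (m n : ℕ) :
    kIter P (m + n) = kIter P m ∘ₖ kIter P n := by
  simp only [kIter_eq_pow, pow_add]
  rfl

theorem invariant_kIter {X : Type*} [MeasurableSpace X] {P : Kernel X X} {π : Measure X}
    (hinv : Kernel.Invariant P π) (n : ℕ) : Kernel.Invariant (kIter P n) π := by
  induction n with
  | zero => exact Measure.id_comp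
  | succ n ih => exact ih.comp hinv

/-- The mass a measure pushed through a kernel gives to a set, as a Bochner integral. -/
theorem measureReal_bind_eq_integral {X : Type*} [MeasurableSpace X] (K : Kernel X X)
    [IsMarkovKernel K] (μ : Measure X) {A : Set X} (hA : MeasurableSet A) :
    (μ.bind K).real A = ∫ y, (K y).real A ∂μ := by
  rw [measureReal_def, Measure.bind_apply hA K.aemeasurable]
  exact (integral_toReal (K.measurable_coe hA).aemeasurable
    (Filter.Eventually.of_forall fun y => measure_lt_top _ _)).symm

theorem integral_mem_Icc_of_forall_mem_Icc {X : Type*} [MeasurableSpace X] (μ : Measure X)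
    [IsFiniteMeasure μ] {f : X → ℝ} (hf : Measurable f) {a b : ℝ}
    (h : ∀ x, f x ∈ Set.Icc a b) :
    ∫ x, f x ∂μ ∈ Set.Icc (μ.real Set.univ * a) (μ.real Set.univ * b) := by
  have hi : Integrable f μ :=
    Integrable.of_mem_Icc a b hf.aemeasurable (Filter.Eventually.of_forall h)
  constructor
  · simpa using integral_mono (integrable_const a) hi fun x => (h x).1
  · simpa using integral_mono hi (integrable_const b) fun x => (h x).2

/-- A kernel minorized by `ε • Q` contracts the range of bounded functions by `1 - ε`. -/
theorem exists_forall_integral_mem_Icc_of_minorization {X : Type*} [MeasurableSpace X]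
    (K : Kernel X X) [IsMarkovKernel K] {ε : ℝ} (hε : 0 ≤ ε)
    (Q : Measure X) [IsProbabilityMeasure Q]
    (hminor : ∀ (x : X) (A : Set X), MeasurableSet A → ENNReal.ofReal ε * Q A ≤ K x A)
    {f : X → ℝ} (hf : Measurable f) {a d : ℝ} (h : ∀ x, f x ∈ Set.Icc a (a + d)) :
    ∃ c, ∀ x, ∫ y, f y ∂(K x) ∈ Set.Icc c (c + (1 - ε) * d) := by
  refine ⟨ε * ∫ y, f y ∂Q + (1 - ε) * a, fun x => ?_⟩
  have : IsFiniteMeasure (ENNReal.ofReal ε • Q) := Q.smul_finite ENNReal.ofReal_ne_top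
  have hle : ENNReal.ofReal ε • Q ≤ K x :=
    Measure.le_iff.2 fun A hA => by simpa using hminor x A hA
  have hfi (μ : Measure X) [IsFiniteMeasure μ] : Integrable f μ :=
    Integrable.of_mem_Icc _ _ hf.aemeasurable (Filter.Eventually.of_forall h)
  set ρ := K x - ENNReal.ofReal ε • Q
  have hsum : ρ + ENNReal.ofReal ε • Q = K x := Measure.sub_add_cancel_of_le hle
  have hmass : ρ.real Set.univ = 1 - ε := by
    have := congrArg (fun μ : Measure X => μ.real Set.univ) hsum
    simp [measureReal_add_apply, measureReal_ennreal_smul_apply, hε] at this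
    linarith
  have h_int : ∫ y, f y ∂(K x) = ∫ y, f y ∂ρ + ε * ∫ y, f y ∂Q := by
    rw [← hsum, integral_add_measure (hfi _) (hfi _), integral_smul_measure,
      ENNReal.toReal_ofReal hε, smul_eq_mul]
  have hb := integral_mem_Icc_of_forall_mem_Icc ρ hf h
  rw [hmass] at hb
  rw [h_int]
  constructor <;> linarith [hb.1, hb.2]

/-- If a Markov kernel `P` with invariant probability measure `π` satisfies a minorization
condition `P^{n₀}(x, A) ≥ ε Q(A)` on the whole space, then the chain is uniformly ergodic:
`|P^n(x, A) − π(A)| ≤ (1 − ε)^{⌊n / n₀⌋}`. -/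
theorem uniform_ergodicity_of_minorization
    {X : Type*} [MeasurableSpace X] (P : Kernel X X) [IsMarkovKernel P]
    (π : Measure X) [IsProbabilityMeasure π] (hinv : Kernel.Invariant P π)
    (n₀ : ℕ) (hn₀ : 1 ≤ n₀)
    (ε : ℝ) (hε0 : 0 < ε) (hε1 : ε ≤ 1)
    (Q : Measure X) [IsProbabilityMeasure Q]
    (hminor : ∀ (x : X) (A : Set X), MeasurableSet A →
      ENNReal.ofReal ε * Q A ≤ kIter P n₀ x A) :
    ∀ (n : ℕ), 1 ≤ n → ∀ (x : X) (A : Set X), MeasurableSet A →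
      |(kIter P n x A).toReal - (π A).toReal| ≤ (1 - ε) ^ (n / n₀) := by
  intro n _ x A hA
  have key : ∀ k r : ℕ, ∃ a, ∀ y,
      (kIter P (r + n₀ * k) y).real A ∈ Set.Icc a (a + (1 - ε) ^ k) := by
    intro k r
    induction k with
    | zero => exact ⟨0, fun y => by simp⟩
    | succ k ih =>
      obtain ⟨a, ha⟩ := ih
      obtain ⟨c, hc⟩ := exists_forall_integral_mem_Icc_of_minorization (kIter P n₀) hε0.le Q
        hminor ((kIter P (r + n₀ * k)).measurable_coe hA).ennreal_toReal ha
      refine ⟨c, fun y => ?_⟩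
      rw [Nat.mul_succ, ← add_assoc, kIter_add, Kernel.comp_apply,
        measureReal_bind_eq_integral _ _ hA, pow_succ']
      exact hc y
  obtain ⟨a, ha⟩ := key (n / n₀) (n % n₀)
  rw [Nat.mod_add_div] at ha
  have hπ := integral_mem_Icc_of_forall_mem_Icc π
    ((kIter P n).measurable_coe hA).ennreal_toReal ha
  change ∫ y, (kIter P n y).real A ∂π ∈ _ at hπ
  rw [← measureReal_bind_eq_integral _ _ hA, (invariant_kIter hinv n).def, probReal_univ,
    one_mul, one_mul] at hπ
  have hx := ha x
  simp only [measureReal_def] at hx hπ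
  rw [abs_le]
  constructor <;> linarith [hx.1, hx.2, hπ.1, hπ.2]
end

section
/- Let π be a probability density on X = X_1 × ⋯ × X_d and for each i = 1, …, d let p_i(x, ·) be a proposal density on X_i depending on the full state x ∈ X. Suppose there are positive functions w_1, …, w_d on X such that w_i(x) p_i(x, y_i) = w_i(y) p_i(y, x_i) for all x, y ∈ X, and set r_i(x) = π(x)/w_i(x). Suppose there are functions g_{i1}, g_{i2}, h_{i1}, h_{i2} such that for any x with π(x) > 0, 0 ≤ g_{i1}(x_{[i]}) g_{i2}(x^{[i+1]}) ≤ r_i(x) ≤ h_{i1}(x_{[i-1]}) h_{i2}(x^{[i]}) for each i = 1, …, d, with h_{i1}, h_{i2} > 0. Then for any constants c_i > 0, the i-th acceptance probability of the composition sampler, α_i((y_{[i-1]}, x^{[i]}), y_i) = min{1, [π(y_{[i]}, x^{[i+1]}) p_i((y_{[i]}, x^{[i+1]}), x_i)] / [π(y_{[i-1]}, x^{[i]}) p_i((y_{[i-1]}, x^{[i]}), y_i)]}, satisfies α_i((y_{[i-1]}, x^{[i]}), y_i) ≥ min{1, c_i g_{i1}(y_{[i]})/h_{i1}(y_{[i-1]})}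 · min{1, g_{i2}(x^{[i+1]})/(c_i h_{i2}(x^{[i]}))}, for all x, y with π(y_{[i-1]}, x^{[i]}) > 0 and π(y_{[i]}, x^{[i+1]}) > 0. -/
/-- `spl k x y` is the point whose first `k` coordinates come from `x` and whose remaining
coordinates come from `y`; it realizes the concatenation `(x_{[k]}, y^{[k+1]})`. -/
def spl {d : ℕ} {X : Fin d → Type*} (k : ℕ) (x y : ∀ j, X j) : ∀ j, X j :=
  fun j => if (j : ℕ) < k then x j else y j

/-- `DepLt k g` : the function `g` depends only on the coordinates with index `< k`. -/
def DepLt {d : ℕ} {X : Fin d → Type*} (k : ℕ) (g : (∀ j, X j) → ℝ) : Prop :=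
  ∀ a b : ∀ j, X j, (∀ j : Fin d, (j : ℕ) < k → a j = b j) → g a = g b

/-- `DepGe k g` : the function `g` depends only on the coordinates with index `≥ k`. -/
def DepGe {d : ℕ} {X : Fin d → Type*} (k : ℕ) (g : (∀ j, X j) → ℝ) : Prop :=
  ∀ a b : ∀ j, X j, (∀ j : Fin d, k ≤ (j : ℕ) → a j = b j) → g a = g b

/-- The truncations at `1` of two nonnegative reals multiply to at most the truncation of any
upper bound of their product. -/
theorem min_one_mul_min_one_le {a b t : ℝ} (ha : 0 ≤ a) (hb : 0 ≤ b) (h : a * b ≤ t) :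
    min 1 a * min 1 b ≤ min 1 t :=
  le_min
    (mul_le_one₀ (min_le_left _ _) (le_min zero_le_one hb) (min_le_left _ _))
    ((mul_le_mul (min_le_right _ _) (min_le_right _ _) (le_min zero_le_one hb) ha).trans h)

/-- Lower bound on the acceptance probability of the `i`-th component update of the
composition sampler: if `w_i(x) p_i(x, y_i) = w_i(y) p_i(y, x_i)` and
`0 ≤ g_{i1}(x_{[i]}) g_{i2}(x^{[i+1]}) ≤ r_i(x) = π(x)/w_i(x) ≤ h_{i1}(x_{[i-1]}) h_{i2}(x^{[i]})`
whenever `π(x) > 0`, then for every `c_i > 0`,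
`α_i((y_{[i-1]}, x^{[i]}), y_i) ≥ min{1, c_i g_{i1}(y_{[i]})/h_{i1}(y_{[i-1]})} ⬝
  min{1, g_{i2}(x^{[i+1]})/(c_i h_{i2}(x^{[i]}))}`
whenever `π(y_{[i-1]}, x^{[i]}) > 0` and `π(y_{[i]}, x^{[i+1]}) > 0`. -/
theorem acceptance_probability_lower_bound
    {d : ℕ} {X : Fin d → Type*}
    (π : (∀ j, X j) → ℝ)
    -- `pp i x t` is the proposal density `p_i(x, t)` for the `i`-th coordinate
    (pp : ∀ i : Fin d, (∀ j, X j) → X i → ℝ)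
    (hppos : ∀ (i : Fin d) (x : ∀ j, X j) (t : X i), 0 < pp i x t)
    (w : Fin d → (∀ j, X j) → ℝ) (hw : ∀ (i : Fin d) (x : ∀ j, X j), 0 < w i x)
    (hbal : ∀ (i : Fin d) (x y : ∀ j, X j),
      w i x * pp i x (y i) = w i y * pp i y (x i))
    (g1 g2 h1 h2 : Fin d → (∀ j, X j) → ℝ)
    (hg1dep : ∀ i : Fin d, DepLt ((i : ℕ) + 1) (g1 i))
    (hg2dep : ∀ i : Fin d, DepGe ((i : ℕ) + 1) (g2 i))
    (hh1dep : ∀ i : Fin d, DepLt (i : ℕ) (h1 i))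
    (hh2dep : ∀ i : Fin d, DepGe (i : ℕ) (h2 i))
    (hg1nn : ∀ (i : Fin d) (x : ∀ j, X j), 0 ≤ g1 i x)
    (hg2nn : ∀ (i : Fin d) (x : ∀ j, X j), 0 ≤ g2 i x)
    (hh1pos : ∀ (i : Fin d) (x : ∀ j, X j), 0 < h1 i x)
    (hh2pos : ∀ (i : Fin d) (x : ∀ j, X j), 0 < h2 i x)
    (hsand : ∀ (i : Fin d) (x : ∀ j, X j), 0 < π x →
      g1 i x * g2 i x ≤ π x / w i x ∧ π x / w i x ≤ h1 i x * h2 i x) :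
    ∀ (c : Fin d → ℝ), (∀ i, 0 < c i) →
      ∀ (i : Fin d) (x y : ∀ j, X j),
        0 < π (spl (i : ℕ) y x) → 0 < π (spl ((i : ℕ) + 1) y x) →
        min 1 (c i * g1 i (spl ((i : ℕ) + 1) y x) / h1 i (spl (i : ℕ) y x)) *
          min 1 (g2 i (spl ((i : ℕ) + 1) y x) / (c i * h2 i (spl (i : ℕ) y x))) ≤
        min 1 ((π (spl ((i : ℕ) + 1) y x) * pp i (spl ((i : ℕ) + 1) y x) (x i)) /
          (π (spl (i : ℕ) y x) * pp i (spl (i : ℕ) y x) (y i))) := by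
  intro c hc i x y hu hv
  have hui : spl (i : ℕ) y x i = x i := by simp [spl]
  have hvi : spl ((i : ℕ) + 1) y x i = y i := by simp [spl]
  have hb := hbal i (spl ((i : ℕ) + 1) y x) (spl (i : ℕ) y x)
  rw [hui, hvi] at hb
  have hlow := (hsand i _ hv).1
  have hupp := (hsand i _ hu).2
  have hp := hppos i (spl (i : ℕ) y x) (y i)
  have hwu := hw i (spl (i : ℕ) y x)
  have hwv := hw i (spl ((i : ℕ) + 1) y x)
  have hg1 := hg1nn i (spl ((i : ℕ) + 1) y x)
  have hg2 := hg2nn i (spl ((i : ℕ) + 1) y x)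
  have hh1 := hh1pos i (spl (i : ℕ) y x)
  have hh2 := hh2pos i (spl (i : ℕ) y x)
  have hci := hc i
  generalize spl (i : ℕ) y x = u at *
  generalize spl ((i : ℕ) + 1) y x = v at *
  refine min_one_mul_min_one_le (by positivity) (by positivity) ?_
  have hratio : π v * pp i v (x i) / (π u * pp i u (y i)) = (π v / w i v) / (π u / w i u) := by
    field_simp
    linear_combination hb
  calc c i * g1 i v / h1 i u * (g2 i v / (c i * h2 i u))
      = g1 i v * g2 i v / (h1 i u * h2 i u) := by field_simp
    _ ≤ (π v / w i v) / (π u / w i u) :=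
        div_le_div₀ (by positivity) hlow (by positivity) hupp
    _ = _ := hratio.symm
end

section
/- Consider a variable-at-a-time Metropolis–Hastings sampler with composition transition density f_comp(x, y) = ∏_{i=1}^d f_i(x_i, y_i | y_{[i-1]}, x^{[i+1]}), where each f_i is the Metropolis–Hastings transition density with proposal density p_i((y_{[i-1]}, x^{[i]}), ·) and target π. Assume: (i) for each i there exist positive functions s_i on X_i × ⋯ × X_d and q_i on X_1 × ⋯ × X_i such that p_i((y_{[i-1]}, x^{[i]}), y_i) ≥ s_i(x^{[i]}) q_i(y_{[i]}); (ii) there are positive functions w_i on X with w_i(x) p_i(x, y_i) = w_i(y) p_i(y, x_i) for all x, y ∈ X; (iii) with r_i(x) = π(x)/w_i(x), there exist functions g_{i1}, g_{i2}, h_{i1}, h_{i2} (with h_{i1}, h_{i2} > 0) such that for any x with π(x) > 0, 0 ≤ g_{i1}(x_{[i]}) g_{i2}(x^{[i+1]}) ≤ r_i(x) ≤ h_{i1}(x_{[i-1]}) h_{i2}(x^{[i]}) for each i = 1, …, d. Then for any constants c_i > 0 and all x, y with π positive along the intermediate states (y_{[i-1]}, x^{[i]}), f_comp(x, y) ≥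 ∏_{i=1}^d s_i(x^{[i]}) min{1, g_{i2}(x^{[i+1]})/(c_i h_{i2}(x^{[i]}))} · q_i(y_{[i]}) min{1, c_i g_{i1}(y_{[i]})/h_{i1}(y_{[i-1]})}. In particular this implies a minorization condition of the form P(x, dy) ≥ s(x) Q(dy) with s(x) proportional to ∏_i s_i(x^{[i]}) min{1, g_{i2}(x^{[i+1]})/(c_i h_{i2}(x^{[i]}))} and Q having density proportional to ∏_i q_i(y_{[i]}) min{1, c_i g_{i1}(y_{[i]})/h_{i1}(y_{[i-1]})}. -/
theorem spl_of_lt {d : ℕ} {X : Fin d → Type*} {k : ℕ} (x y : ∀ j, X j) {j : Fin d}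
    (h : (j : ℕ) < k) : spl k x y j = x j :=
  if_pos h

theorem spl_of_le {d : ℕ} {X : Fin d → Type*} {k : ℕ} (x y : ∀ j, X j) {j : Fin d}
    (h : k ≤ (j : ℕ)) : spl k x y j = y j :=
  if_neg h.not_gt

theorem DepLt.apply_spl {d : ℕ} {X : Fin d → Type*} {k : ℕ} {g : (∀ j, X j) → ℝ}
    (hg : DepLt k g) (x y : ∀ j, X j) : g (spl k x y) = g x :=
  hg _ _ fun _ h => spl_of_lt x y h

theorem DepGe.apply_spl {d : ℕ} {X : Fin d → Type*} {k : ℕ} {g : (∀ j, X j) → ℝ}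
    (hg : DepGe k g) (x y : ∀ j, X j) : g (spl k x y) = g y :=
  hg _ _ fun _ h => spl_of_le x y h

theorem min_one_mul_min_one_le_s9 {u v : ℝ} (hu : 0 ≤ u) (hv : 0 ≤ v) :
    min 1 u * min 1 v ≤ min 1 (u * v) :=
  le_min
    (mul_le_one₀ (min_le_left _ _) (le_min zero_le_one hv) (min_le_left _ _))
    (mul_le_mul (min_le_right _ _) (min_le_right _ _) (le_min zero_le_one hv) hu)

/-- Minorization in product form for the composition sampler (regenerative simulation):
under the proposal minorization `p_i((y_{[i-1]}, x^{[i]}), y_i) ≥ s_i(x^{[i]}) q_i(y_{[i]})`,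
the balance condition `w_i(x) p_i(x, y_i) = w_i(y) p_i(y, x_i)`, and the sandwich
`0 ≤ g_{i1}(x_{[i]}) g_{i2}(x^{[i+1]}) ≤ r_i(x) = π(x)/w_i(x) ≤ h_{i1}(x_{[i-1]}) h_{i2}(x^{[i]})`
for `π(x) > 0`, the composition transition density satisfies, for any `c_i > 0`,
`f_comp(x, y) ≥ [∏ s_i(x^{[i]}) min{1, g_{i2}(x^{[i+1]})/(c_i h_{i2}(x^{[i]}))}] ⬝
  [∏ q_i(y_{[i]}) min{1, c_i g_{i1}(y_{[i]})/h_{i1}(y_{[i-1]})}]`,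
a minorization of the form `P(x, dy) ≥ s(x) q(y) μ(dy)`. -/
theorem composition_minorization_for_regeneration
    {d : ℕ} {X : Fin d → Type*}
    (π : (∀ j, X j) → ℝ)
    -- `pp i x t` is the proposal density `p_i(x, t)` for the `i`-th coordinate
    (pp : ∀ i : Fin d, (∀ j, X j) → X i → ℝ)
    (hppos : ∀ (i : Fin d) (x : ∀ j, X j) (t : X i), 0 < pp i x t)
    -- `f i x y` is the `i`-th Metropolis–Hastings component transition density
    (f : Fin d → (∀ j, X j) → (∀ j, X j) → ℝ)
    (hf : ∀ (i : Fin d) (x y : ∀ j, X j),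
      pp i (spl (i : ℕ) y x) (y i) *
        min 1 ((π (spl ((i : ℕ) + 1) y x) * pp i (spl ((i : ℕ) + 1) y x) (x i)) /
          (π (spl (i : ℕ) y x) * pp i (spl (i : ℕ) y x) (y i))) ≤ f i x y)
    (w : Fin d → (∀ j, X j) → ℝ) (hw : ∀ (i : Fin d) (x : ∀ j, X j), 0 < w i x)
    (hbal : ∀ (i : Fin d) (x y : ∀ j, X j),
      w i x * pp i x (y i) = w i y * pp i y (x i))
    (s q : Fin d → (∀ j, X j) → ℝ)
    (hsdep : ∀ i : Fin d, DepGe (i : ℕ) (s i))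
    (hqdep : ∀ i : Fin d, DepLt ((i : ℕ) + 1) (q i))
    (hspos : ∀ (i : Fin d) (x : ∀ j, X j), 0 < s i x)
    (hqpos : ∀ (i : Fin d) (x : ∀ j, X j), 0 < q i x)
    (hsq : ∀ (i : Fin d) (x y : ∀ j, X j),
      s i x * q i y ≤ pp i (spl (i : ℕ) y x) (y i))
    (g1 g2 h1 h2 : Fin d → (∀ j, X j) → ℝ)
    (hg1dep : ∀ i : Fin d, DepLt ((i : ℕ) + 1) (g1 i))
    (hg2dep : ∀ i : Fin d, DepGe ((i : ℕ) + 1) (g2 i))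
    (hh1dep : ∀ i : Fin d, DepLt (i : ℕ) (h1 i))
    (hh2dep : ∀ i : Fin d, DepGe (i : ℕ) (h2 i))
    (hg1nn : ∀ (i : Fin d) (x : ∀ j, X j), 0 ≤ g1 i x)
    (hg2nn : ∀ (i : Fin d) (x : ∀ j, X j), 0 ≤ g2 i x)
    (hh1pos : ∀ (i : Fin d) (x : ∀ j, X j), 0 < h1 i x)
    (hh2pos : ∀ (i : Fin d) (x : ∀ j, X j), 0 < h2 i x)
    (hsand : ∀ (i : Fin d) (x : ∀ j, X j), 0 < π x →
      g1 i x * g2 i x ≤ π x / w i x ∧ π x / w i x ≤ h1 i x * h2 i x) :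
    ∀ (c : Fin d → ℝ), (∀ i, 0 < c i) →
      ∀ x y : ∀ j, X j, (∀ k : ℕ, k ≤ d → 0 < π (spl k y x)) →
        (∏ i : Fin d, s i x * min 1 (g2 i x / (c i * h2 i x))) *
          (∏ i : Fin d, q i y * min 1 (c i * g1 i y / h1 i y)) ≤
        ∏ i : Fin d, f i x y := by
  intro c hc x y hπ
  rw [← Finset.prod_mul_distrib]
  have hu (i : Fin d) : 0 ≤ g2 i x / (c i * h2 i x) :=
    div_nonneg (hg2nn i x) (mul_pos (hc i) (hh2pos i x)).le
  have hv (i : Fin d) : 0 ≤ c i * g1 i y / h1 i y :=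
    div_nonneg (mul_nonneg (hc i).le (hg1nn i y)) (hh1pos i y).le
  refine Finset.prod_le_prod (fun i _ => ?_) (fun i _ => ?_)
  · exact mul_nonneg
      (mul_nonneg (hspos i x).le (le_min zero_le_one (hu i)))
      (mul_nonneg (hqpos i y).le (le_min zero_le_one (hv i)))
  refine le_trans ?_ (hf i x y)
  have hπa := hπ i i.isLt.le
  have hπb := hπ (i + 1) i.isLt
  have hbal' := hbal i (spl i y x) (spl (i + 1) y x)
  rw [spl_of_lt y x (Nat.lt_succ_self (i : ℕ)), spl_of_le y x (le_refl (i : ℕ))] at hbal'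
  have hlow := (hsand i _ hπb).1
  have hupp := (hsand i _ hπa).2
  rw [(hg1dep i).apply_spl, (hg2dep i).apply_spl] at hlow
  rw [(hh1dep i).apply_spl, (hh2dep i).apply_spl] at hupp
  have hpa := hppos i (spl i y x) (y i)
  have hsqi := hsq i x y
  have hwa := hw i (spl i y x)
  have hwb := hw i (spl (i + 1) y x)
  set a := spl (i : ℕ) y x
  set b := spl ((i : ℕ) + 1) y x
  have hratio : π b * pp i b (x i) / (π a * pp i a (y i)) = π b / w i b / (π a / w i a) := by
    field_simp
    linear_combination -hbal'
  have hprod : g2 i x / (c i * h2 i x) * (c i * g1 i y / h1 i y) =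
      g1 i y * g2 i x / (h1 i y * h2 i x) := by
    have := (hc i).ne'
    have := (hh1pos i y).ne'
    have := (hh2pos i x).ne'
    field_simp
  have hacc : g2 i x / (c i * h2 i x) * (c i * g1 i y / h1 i y) ≤
      π b * pp i b (x i) / (π a * pp i a (y i)) := by
    rw [hprod, hratio]
    exact div_le_div₀ (div_pos hπb hwb).le hlow (div_pos hπa hwa) hupp
  calc s i x * min 1 (g2 i x / (c i * h2 i x)) * (q i y * min 1 (c i * g1 i y / h1 i y))
      = s i x * q i y *
          (min 1 (g2 i x / (c i * h2 i x)) * min 1 (c i * g1 i y / h1 i y)) := by ring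
    _ ≤ pp i a (y i) * min 1 (π b * pp i b (x i) / (π a * pp i a (y i))) :=
        mul_le_mul hsqi
          ((min_one_mul_min_one_le_s9 (hu i) (hv i)).trans (min_le_min_left 1 hacc))
          (mul_nonneg (le_min zero_le_one (hu i)) (le_min zero_le_one (hv i))) hpa.le
end

section
/- Let m ≥ 1 be an integer, ȳ ∈ ℝ, s² > 0, and let A ⊆ ℝ be a bounded Borel set with M = sup_{μ ∈ A} |μ − ȳ| < ∞. Then for every μ ∈ A and every θ > 0, exp{ −(m/2)(1/s² − 1/θ)(μ − ȳ)² } ≥ exp{ −(m/(2 s²)) M² }. Consequently, in the Bayesian normal model with posterior density π(μ, θ) ∝ θ^{−(m+1)/2} exp{ −(1/(2θ))[ s² + m(μ − ȳ)² ] } 1_A(μ) 1_B(θ) and independence-sampler proposal density p(μ, θ) given by the product of a Normal(ȳ, s²/m) density truncated to A and an InverseGamma((m−1)/2, s²/2) density truncated to B (so that p(μ, θ)/π(μ, θ) is proportional to exp{ −(m/2)(1/s² − 1/θ)(μ − ȳ)² }), there exists ε > 0 such that p(μ, θ) ≥ ε π(μ, θ) for all (μ, θ) ∈ A × B, and hence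 the Metropolis–Hastings independence sampler is uniformly ergodic. -/
open MeasureTheory ProbabilityTheory
open scoped ENNReal Classical

/-- Uniform ergodicity on the state space `S`: geometric convergence in total variation,
uniformly over starting points in `S`. -/
def UnifErgodicOn {Y : Type*} [MeasurableSpace Y] (P : Kernel Y Y) (π : Measure Y)
    (S : Set Y) : Prop :=
  ∃ C t : ℝ, 0 ≤ C ∧ 0 ≤ t ∧ t < 1 ∧
    ∀ (n : ℕ), ∀ x ∈ S, ∀ A : Set Y, MeasurableSet A →
      |(kIter P n x A).toReal - (π A).toReal| ≤ C * t ^ n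

/-- The (unnormalized) posterior density
`π(μ, θ) ∝ θ^{-(m+1)/2} exp(-(s² + m(μ-ȳ)²)/(2θ))` on `A × B`. -/
noncomputable def toyPost (m : ℕ) (ybar s2 : ℝ) (A B : Set ℝ) (c1 : ℝ) : ℝ × ℝ → ℝ :=
  fun z => if z.1 ∈ A ∧ z.2 ∈ B then
    c1 * z.2 ^ (-(((m : ℝ) + 1) / 2)) *
      Real.exp (-(s2 + (m : ℝ) * (z.1 - ybar) ^ 2) / (2 * z.2))
  else 0

/-- The independence-sampler proposal density: product of a `N(ȳ, s²/m)` density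
truncated to `A` and an `IG((m-1)/2, s²/2)` density truncated to `B`. -/
noncomputable def toyProp (m : ℕ) (ybar s2 : ℝ) (A B : Set ℝ) (c2 : ℝ) : ℝ × ℝ → ℝ :=
  fun z => if z.1 ∈ A ∧ z.2 ∈ B then
    c2 * Real.exp (-((m : ℝ) * (z.1 - ybar) ^ 2) / (2 * s2)) *
      z.2 ^ (-(((m : ℝ) + 1) / 2)) * Real.exp (-s2 / (2 * z.2))
  else 0

/-- A Doeblin minorization on an absorbing set of full measure forces geometric convergence in
total variation to the invariant probability measure, uniformly over that set. -/
lemma unifErgodicOn_of_minorization {X : Type*} [MeasurableSpace X] (P : Kernel X X)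
    [IsMarkovKernel P] (π : Measure X) [IsProbabilityMeasure π] (S : Set X)
    (hinv : Kernel.Invariant P π) (hπS : ∀ᵐ y ∂π, y ∈ S) (hPS : ∀ x ∈ S, ∀ᵐ y ∂(P x), y ∈ S)
    (ε : ℝ) (hε : 0 < ε) (hmin : ∀ x ∈ S, ENNReal.ofReal ε • π ≤ P x) :
    UnifErgodicOn P π S := by
  obtain ⟨x₀, hx₀⟩ := hπS.exists
  have hε1 : ε ≤ 1 := by
    have h := hmin x₀ hx₀ Set.univ
    simpa using h
  have hmarkov : ∀ n, IsMarkovKernel (kIter P n) := by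
    intro n
    induction n with
    | zero => rw [kIter]; infer_instance
    | succ k ih => rw [kIter]; infer_instance
  have hinvIter : ∀ n, Kernel.Invariant (kIter P n) π := by
    intro n
    induction n with
    | zero => rw [kIter]; simp [Kernel.Invariant]
    | succ k ih => rw [kIter]; exact ih.comp hinv
  refine ⟨1, 1 - ε, zero_le_one, by linarith, by linarith, ?_⟩
  intro n x hx D hD
  rw [one_mul]
  induction n generalizing x with
  | zero =>
    rw [pow_zero, abs_sub_le_iff]
    have h1 : (kIter P 0 x).real D ≤ 1 := by have := hmarkov 0; exact measureReal_le_one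
    have h2 : π.real D ≤ 1 := measureReal_le_one
    have h3 : 0 ≤ (kIter P 0 x).real D := measureReal_nonneg
    have h4 : 0 ≤ π.real D := measureReal_nonneg
    simp only [Measure.real] at h1 h2 h3 h4
    constructor <;> linarith
  | succ k ih =>
    have := hmarkov k
    set h : X → ℝ := fun y => (kIter P k y D).toReal - (π D).toReal with hh
    have hmeas : Measurable fun y => (kIter P k y D).toReal :=
      ((kIter P k).measurable_coe hD).ennreal_toReal
    have hint0 : ∀ (μ : Measure X) [IsFiniteMeasure μ],
        Integrable (fun y => (kIter P k y D).toReal) μ := by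
      intro μ _
      refine Integrable.of_bound hmeas.aestronglyMeasurable 1 (Filter.Eventually.of_forall ?_)
      intro y
      rw [Real.norm_of_nonneg ENNReal.toReal_nonneg]
      exact measureReal_le_one (μ := kIter P k y)
    have hint : ∀ (μ : Measure X) [IsFiniteMeasure μ], Integrable h μ := by
      intro μ _
      exact (hint0 μ).sub (integrable_const _)
    have htoReal : ∀ (μ : Measure X) [IsProbabilityMeasure μ],
        ∫ y, h y ∂μ = (∫⁻ y, kIter P k y D ∂μ).toReal - (π D).toReal := by
      intro μ _
      rw [hh, integral_sub (hint0 μ) (integrable_const _), integral_toReal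
        ((kIter P k).measurable_coe hD).aemeasurable
        (Filter.Eventually.of_forall fun y => measure_lt_top _ _)]
      simp
    have hπ0 : ∫ y, h y ∂π = 0 := by
      rw [htoReal π, ← Measure.bind_apply hD (kIter P k).aemeasurable, hinvIter k, sub_self]
    have hfin : IsFiniteMeasure (ENNReal.ofReal ε • π) := π.smul_finite ENNReal.ofReal_ne_top
    set ρ : Measure X := P x - ENNReal.ofReal ε • π
    have hρadd : ρ + ENNReal.ofReal ε • π = P x := Measure.sub_add_cancel_of_le (hmin x hx)
    have hρle : ρ ≤ P x := Measure.sub_le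
    have hρfin : IsFiniteMeasure ρ := isFiniteMeasure_of_le _ hρle
    have hρmass : ρ.real Set.univ = 1 - ε := by
      have h1 : (ρ + ENNReal.ofReal ε • π).real Set.univ = 1 := by rw [hρadd]; simp
      rw [measureReal_add_apply] at h1
      simp [hε.le] at h1
      linarith
    have hstep : (kIter P (k + 1) x D).toReal - (π D).toReal = ∫ y, h y ∂ρ := by
      rw [kIter, Kernel.comp_apply' _ _ _ hD, ← htoReal (P x), ← hρadd,
        integral_add_measure (hint ρ) (hint _), integral_smul_measure, hπ0]
      simp
    rw [hstep, ← Real.norm_eq_abs]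
    have hb : ∀ᵐ y ∂ρ, ‖h y‖ ≤ (1 - ε) ^ k := by
      filter_upwards [(Measure.absolutelyContinuous_of_le hρle).ae_le (hPS x hx)] with y hy
      exact ih y hy
    calc ‖∫ y, h y ∂ρ‖ ≤ (1 - ε) ^ k * ρ.real Set.univ := norm_integral_le_of_norm_le_const hb
      _ = (1 - ε) ^ (k + 1) := by rw [hρmass, pow_succ]

/-- A Metropolis–Hastings independence sampler whose proposal density dominates a positive
multiple of the target density is uniformly ergodic. -/
lemma unifErgodicOn_independenceSampler {X : Type*} [MeasurableSpace X] (ν : Measure X)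
    [SFinite ν] (f g : X → ℝ) (hf : Measurable f) (hg : Measurable g)
    (S : Set X) (hS : MeasurableSet S) (hfpos : ∀ x ∈ S, 0 < f x) (hgpos : ∀ x ∈ S, 0 < g x)
    (hfz : ∀ x ∉ S, f x = 0) (hgz : ∀ x ∉ S, g x = 0)
    (ε : ℝ) (hε : 0 < ε) (hfg : ∀ x ∈ S, ε * f x ≤ g x)
    (hgdens : ∫⁻ z, ENNReal.ofReal (g z) ∂ν = 1)
    [hprob : IsProbabilityMeasure (ν.withDensity fun z => ENNReal.ofReal (f z))]
    (P : Kernel X X) [IsMarkovKernel P]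
    (hP : ∀ (x : X) (D : Set X), MeasurableSet D →
      P x D = (∫⁻ y in D, ENNReal.ofReal (min 1 ((f y * g x) / (f x * g y))) *
          ENNReal.ofReal (g y) ∂ν) +
        (1 - ∫⁻ y, ENNReal.ofReal (min 1 ((f y * g x) / (f x * g y))) *
          ENNReal.ofReal (g y) ∂ν) * D.indicator 1 x) :
    UnifErgodicOn P (ν.withDensity fun z => ENNReal.ofReal (f z)) S := by
  have hf0 : ∀ x, 0 ≤ f x := fun x => by
    by_cases hx : x ∈ S
    exacts [(hfpos x hx).le, (hfz x hx).ge]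
  have hg0 : ∀ x, 0 ≤ g x := fun x => by
    by_cases hx : x ∈ S
    exacts [(hgpos x hx).le, (hgz x hx).ge]
  set q : X → X → ℝ≥0∞ := fun x y =>
    ENNReal.ofReal (min 1 ((f y * g x) / (f x * g y))) * ENNReal.ofReal (g y) with hq
  change ∀ (x : X) (D : Set X), MeasurableSet D → P x D = (∫⁻ y in D, q x y ∂ν) +
    (1 - ∫⁻ y, q x y ∂ν) * D.indicator 1 x at hP
  have hqmeas : Measurable (Function.uncurry q) := by
    simp only [hq, Function.uncurry_def]
    fun_prop
  have hqx : ∀ x, Measurable (q x) := fun x => hqmeas.comp measurable_prodMk_left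
  have hamp : Measurable fun x => ∫⁻ y, q x y ∂ν := hqmeas.lintegral_prod_right'
  have hq_le : ∀ x y, q x y ≤ ENNReal.ofReal (g y) := fun x y => by
    refine mul_le_of_le_one_left zero_le ?_
    rw [ENNReal.ofReal_le_one]
    exact min_le_left _ _
  have ha_le : ∀ x, ∫⁻ y, q x y ∂ν ≤ 1 := fun x => hgdens ▸ lintegral_mono (hq_le x)
  have hflow : ∀ x y, ENNReal.ofReal (f x) * q x y =
      ENNReal.ofReal (min (f x * g y) (f y * g x)) := by
    intro x y
    by_cases hx : x ∈ S
    · by_cases hy : y ∈ S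
      · have h1 := hfpos x hx
        have h2 := hgpos y hy
        simp only [hq]
        rw [← ENNReal.ofReal_mul' h2.le, ← ENNReal.ofReal_mul h1.le]
        congr 1
        rw [mul_comm _ (g y), ← mul_assoc, mul_min_of_nonneg _ _ (by positivity)]
        congr 1
        · ring
        · field_simp
      · simp [hq, hgz y hy, hfz y hy]
    · simp [hgz x hx, hfz x hx]
  have hsymm : ∀ x y, ENNReal.ofReal (f x) * q x y = ENNReal.ofReal (f y) * q y x := by
    intro x y
    rw [hflow, hflow, min_comm]
  have hq_ge : ∀ x ∈ S, ∀ y, ENNReal.ofReal ε * ENNReal.ofReal (f y) ≤ q x y := by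
    intro x hx y
    by_cases hy : y ∈ S
    · have h1 := hfpos x hx
      have h2 := hgpos y hy
      have h3 := hfpos y hy
      simp only [hq]
      rw [← ENNReal.ofReal_mul' h2.le, ← ENNReal.ofReal_mul hε.le]
      refine ENNReal.ofReal_le_ofReal ?_
      rw [min_mul_of_nonneg _ _ h2.le, le_min_iff, one_mul]
      refine ⟨hfg y hy, ?_⟩
      have h4 : f y * g x / (f x * g y) * g y = f y * g x / f x := by field_simp
      rw [h4, le_div_iff₀ h1]
      nlinarith [mul_le_mul_of_nonneg_left (hfg x hx) h3.le]
    · simp [hfz y hy]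
  have hofS : ∀ (μ : Measure X), μ Sᶜ = 0 → ∀ᵐ y ∂μ, y ∈ S := fun μ h => h
  refine unifErgodicOn_of_minorization P _ S ?_ (hofS _ ?_) (fun x hx => hofS _ ?_) ε hε ?_
  · rw [Kernel.Invariant]
    ext D hD
    rw [Measure.bind_apply hD P.aemeasurable, withDensity_apply _ hD,
      lintegral_withDensity_eq_lintegral_mul _ hf.ennreal_ofReal (P.measurable_coe hD)]
    have hprop : ∫⁻ x, ENNReal.ofReal (f x) * ∫⁻ y in D, q x y ∂ν ∂ν =
        ∫⁻ y in D, ENNReal.ofReal (f y) * ∫⁻ x, q y x ∂ν ∂ν := by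
      have h1 : ∀ x, ENNReal.ofReal (f x) * ∫⁻ y in D, q x y ∂ν =
          ∫⁻ y in D, ENNReal.ofReal (f y) * q y x ∂ν := fun x => by
        rw [← lintegral_const_mul _ (hqx x)]
        simp_rw [hsymm x]
      simp_rw [h1]
      rw [lintegral_lintegral_swap]
      · simp_rw [lintegral_const_mul _ (hqx _)]
      · refine Measurable.aemeasurable ?_
        exact (hf.ennreal_ofReal.comp measurable_snd).mul (hqmeas.comp measurable_swap)
    have hrej : ∫⁻ x, ENNReal.ofReal (f x) * ((1 - ∫⁻ y, q x y ∂ν) * D.indicator 1 x) ∂ν =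
        ∫⁻ x in D, ENNReal.ofReal (f x) * (1 - ∫⁻ y, q x y ∂ν) ∂ν := by
      rw [← lintegral_indicator hD]
      refine lintegral_congr fun x => ?_
      by_cases hx : x ∈ D <;> simp [hx]
    simp only [Pi.mul_apply, hP _ _ hD, mul_add]
    rw [lintegral_add_left, hprop, hrej, ← lintegral_add_left]
    · refine lintegral_congr fun x => ?_
      rw [← mul_add, add_tsub_cancel_of_le (ha_le x), mul_one]
    · exact hf.ennreal_ofReal.mul hamp
    · refine hf.ennreal_ofReal.mul ?_
      exact hqmeas.lintegral_prod_right' (ν := ν.restrict D)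
  · rw [withDensity_apply _ hS.compl]
    refine (setLIntegral_congr_fun hS.compl fun y hy => ?_).trans lintegral_zero
    simp [hfz y hy]
  · rw [hP x _ hS.compl]
    have h1 : ∫⁻ y in Sᶜ, q x y ∂ν = 0 := by
      refine (setLIntegral_congr_fun hS.compl fun y hy => ?_).trans lintegral_zero
      simp [hq, hgz y hy]
    simp [h1, hx]
  · intro x hx
    refine Measure.le_iff.2 fun D hD => ?_
    rw [hP x D hD, Measure.smul_apply, withDensity_apply _ hD, smul_eq_mul,
      ← lintegral_const_mul _ hf.ennreal_ofReal]
    exact (lintegral_mono fun y => hq_ge x hx y).trans le_self_add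

lemma measurable_toyPost (m : ℕ) (ybar s2 : ℝ) {A B : Set ℝ} (hA : MeasurableSet A)
    (hB : MeasurableSet B) (c1 : ℝ) : Measurable (toyPost m ybar s2 A B c1) := by
  unfold toyPost
  exact Measurable.ite (hA.prod hB) (by fun_prop) measurable_const

lemma measurable_toyProp (m : ℕ) (ybar s2 : ℝ) {A B : Set ℝ} (hA : MeasurableSet A)
    (hB : MeasurableSet B) (c2 : ℝ) : Measurable (toyProp m ybar s2 A B c2) := by
  unfold toyProp
  exact Measurable.ite (hA.prod hB) (by fun_prop) measurable_const

/-- The proposal density is the target density times a constant multiple of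
`exp{-(m/2)(1/s² - 1/θ)(μ-ȳ)²}`. -/
lemma toyProp_eq_mul_toyPost (m : ℕ) {ybar s2 : ℝ} (hs2 : 0 < s2) (A B : Set ℝ)
    {c1 : ℝ} (hc1 : 0 < c1) (c2 μ : ℝ) {θ : ℝ} (hθ : 0 < θ) :
    toyProp m ybar s2 A B c2 (μ, θ) =
      c2 / c1 * Real.exp (-((m : ℝ) / 2) * (1 / s2 - 1 / θ) * (μ - ybar) ^ 2) *
        toyPost m ybar s2 A B c1 (μ, θ) := by
  unfold toyProp toyPost
  split_ifs with h
  · have hexp : Real.exp (-((m : ℝ) * (μ - ybar) ^ 2) / (2 * s2)) * Real.exp (-s2 / (2 * θ)) =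
        Real.exp (-((m : ℝ) / 2) * (1 / s2 - 1 / θ) * (μ - ybar) ^ 2) *
          Real.exp (-(s2 + (m : ℝ) * (μ - ybar) ^ 2) / (2 * θ)) := by
      rw [← Real.exp_add, ← Real.exp_add]
      congr 1
      field_simp
      ring
    have hcancel : c2 / c1 * c1 = c2 := div_mul_cancel₀ _ hc1.ne'
    linear_combination (c2 * θ ^ (-(((m : ℝ) + 1) / 2))) * hexp -
      (θ ^ (-(((m : ℝ) + 1) / 2)) *
        Real.exp (-((m : ℝ) / 2) * (1 / s2 - 1 / θ) * (μ - ybar) ^ 2) *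
          Real.exp (-(s2 + (m : ℝ) * (μ - ybar) ^ 2) / (2 * θ))) * hcancel
  · simp

/-- In the toy Bayesian normal model with bounded `A`, the proposal/target ratio
`exp{-(m/2)(1/s² - 1/θ)(μ-ȳ)²}` is bounded below by `exp{-(m/(2s²)) M²}` where
`M = sup_{μ ∈ A} |μ - ȳ|`; consequently there is `ε > 0` with `p ≥ ε π` on `A × B`, and
hence the Metropolis–Hastings independence sampler is uniformly ergodic. -/
theorem toy_MHIS_uniformly_ergodic
    (m : ℕ) (hm : 1 ≤ m) (ybar s2 : ℝ) (hs2 : 0 < s2)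
    (A B : Set ℝ) (hA : MeasurableSet A) (hB : MeasurableSet B)
    (hBpos : B ⊆ Set.Ioi (0 : ℝ))
    (M : ℝ) (hM : ∀ μ ∈ A, |μ - ybar| ≤ M)
    (c1 c2 : ℝ) (hc1 : 0 < c1) (hc2 : 0 < c2)
    -- the proposal density is a probability density and the target is normalized
    (hpdens : ∫⁻ z, ENNReal.ofReal (toyProp m ybar s2 A B c2 z) = 1)
    (hTargetProb : IsProbabilityMeasure
      (volume.withDensity fun z => ENNReal.ofReal (toyPost m ybar s2 A B c1 z)))
    -- `P` is the Metropolis–Hastings independence sampler kernel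
    (P : Kernel (ℝ × ℝ) (ℝ × ℝ)) [IsMarkovKernel P]
    (hP : ∀ (x : ℝ × ℝ) (S : Set (ℝ × ℝ)), MeasurableSet S →
      P x S = (∫⁻ y in S,
          ENNReal.ofReal (min 1 ((toyPost m ybar s2 A B c1 y * toyProp m ybar s2 A B c2 x) /
            (toyPost m ybar s2 A B c1 x * toyProp m ybar s2 A B c2 y))) *
            ENNReal.ofReal (toyProp m ybar s2 A B c2 y)) +
        (1 - ∫⁻ y, ENNReal.ofReal (min 1 ((toyPost m ybar s2 A B c1 y *
              toyProp m ybar s2 A B c2 x) /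
            (toyPost m ybar s2 A B c1 x * toyProp m ybar s2 A B c2 y))) *
            ENNReal.ofReal (toyProp m ybar s2 A B c2 y)) * S.indicator 1 x) :
    (∀ μ ∈ A, ∀ θ : ℝ, 0 < θ →
        Real.exp (-((m : ℝ) / (2 * s2)) * M ^ 2) ≤
          Real.exp (-((m : ℝ) / 2) * (1 / s2 - 1 / θ) * (μ - ybar) ^ 2)) ∧
    (∃ ε > (0 : ℝ), ∀ μ ∈ A, ∀ θ ∈ B,
        ε * toyPost m ybar s2 A B c1 (μ, θ) ≤ toyProp m ybar s2 A B c2 (μ, θ)) ∧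
    UnifErgodicOn P
      (volume.withDensity fun z => ENNReal.ofReal (toyPost m ybar s2 A B c1 z))
      (A ×ˢ B) := by
  have hratio : ∀ μ ∈ A, ∀ θ : ℝ, 0 < θ →
      Real.exp (-((m : ℝ) / (2 * s2)) * M ^ 2) ≤
        Real.exp (-((m : ℝ) / 2) * (1 / s2 - 1 / θ) * (μ - ybar) ^ 2) := by
    intro μ hμ θ hθ
    rw [Real.exp_le_exp]
    have hsq : (μ - ybar) ^ 2 ≤ M ^ 2 := sq_le_sq' (abs_le.1 (hM μ hμ)).1 (abs_le.1 (hM μ hμ)).2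
    have h1 : (m : ℝ) / (2 * s2) * (μ - ybar) ^ 2 ≤ (m : ℝ) / (2 * s2) * M ^ 2 := by gcongr
    have h2 : 0 ≤ (m : ℝ) / 2 * (1 / θ) * (μ - ybar) ^ 2 := by positivity
    have h3 : (m : ℝ) / (2 * s2) = (m : ℝ) / 2 * (1 / s2) := by field_simp
    rw [h3] at h1 ⊢
    linarith
  have hpost : ∀ z ∈ A ×ˢ B, 0 < toyPost m ybar s2 A B c1 z := by
    intro z hz
    have hθ : 0 < z.2 := hBpos hz.2
    rw [toyPost, if_pos (Set.mem_prod.1 hz)]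
    positivity
  have hprop : ∀ z ∈ A ×ˢ B, 0 < toyProp m ybar s2 A B c2 z := by
    intro z hz
    have hθ : 0 < z.2 := hBpos hz.2
    rw [toyProp, if_pos (Set.mem_prod.1 hz)]
    positivity
  obtain ⟨ε, hε, hdom⟩ : ∃ ε > (0 : ℝ), ∀ μ ∈ A, ∀ θ ∈ B,
      ε * toyPost m ybar s2 A B c1 (μ, θ) ≤ toyProp m ybar s2 A B c2 (μ, θ) := by
    refine ⟨c2 / c1 * Real.exp (-((m : ℝ) / (2 * s2)) * M ^ 2), by positivity, ?_⟩
    intro μ hμ θ hθ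
    rw [toyProp_eq_mul_toyPost m hs2 A B hc1 c2 μ (hBpos hθ)]
    have := (hpost (μ, θ) ⟨hμ, hθ⟩).le
    gcongr ?_ * _
    gcongr ?_ * ?_
    exact hratio μ hμ θ (hBpos hθ)
  exact ⟨hratio, ⟨ε, hε, hdom⟩,
    unifErgodicOn_independenceSampler volume _ _ (measurable_toyPost m ybar s2 hA hB c1)
      (measurable_toyProp m ybar s2 hA hB c2) (A ×ˢ B) (hA.prod hB) hpost hprop
      (fun _ hz => if_neg hz) (fun _ hz => if_neg hz) ε hε
      (fun z hz => hdom z.1 hz.1 z.2 hz.2) hpdens P hP⟩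
end

section
/- Let m ≥ 1 be an integer, ȳ ∈ ℝ, let A ⊆ ℝ be a bounded Borel set with M = sup_{μ ∈ A} |μ − ȳ| < ∞, and let θ* > 0. Then for all μ, μ′ ∈ A and all θ, θ′ ≥ θ*, exp{ −(m/2)(1/θ − 1/θ′)[(μ − ȳ)² − (μ′ − ȳ)²] } ≥ exp{ −m M²/(2 θ*) }. Consequently, for the posterior density π(μ, θ) ∝ θ^{−(m+1)/2} exp{ −(1/(2θ))[ s² + m(μ − ȳ)² ] } 1_A(μ) 1_B(θ) with B ⊆ [θ*, ∞), the ratio π(μ, θ) π(μ′, θ′) / [π(μ, θ′) π(μ′, θ)] is bounded below by ε = exp{ −m M²/(2 θ*) } > 0 for all (μ, θ), (μ′, θ′) in A × B, verifying the cross-ratio condition needed for uniform ergodicity of the component-wise independence sampler for this posterior. -/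
open scoped Classical

/-- Exponent bound behind the cross-ratio condition. -/
theorem neg_mul_sq_div_le_cross_exponent {k a b M t θ θ' : ℝ} (hk : 0 ≤ k)
    (ha : |a| ≤ M) (hb : |b| ≤ M) (ht : 0 < t) (hθ : t ≤ θ) (hθ' : t ≤ θ') :
    -k * M ^ 2 / (2 * t) ≤ -(k / 2) * (1 / θ - 1 / θ') * (a ^ 2 - b ^ 2) := by
  have hinv : |1 / θ - 1 / θ'| ≤ 1 / t :=
    abs_sub_le_of_nonneg_of_le (one_div_nonneg.2 (ht.le.trans hθ))
      (one_div_le_one_div_of_le ht hθ) (one_div_nonneg.2 (ht.le.trans hθ'))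
      (one_div_le_one_div_of_le ht hθ')
  have hsq : |a ^ 2 - b ^ 2| ≤ M ^ 2 :=
    abs_sub_le_of_nonneg_of_le (sq_nonneg a) (sq_le_sq' (abs_le.1 ha).1 (abs_le.1 ha).2)
      (sq_nonneg b) (sq_le_sq' (abs_le.1 hb).1 (abs_le.1 hb).2)
  have hprod : (1 / θ - 1 / θ') * (a ^ 2 - b ^ 2) ≤ 1 / t * M ^ 2 := by
    refine (le_abs_self _).trans ?_
    rw [abs_mul]
    gcongr
  calc -k * M ^ 2 / (2 * t) = -(k / 2 * (1 / t * M ^ 2)) := by field_simp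
    _ ≤ -(k / 2 * ((1 / θ - 1 / θ') * (a ^ 2 - b ^ 2))) := by gcongr
    _ = _ := by ring

/-- For bounded `A` (with `|μ - ȳ| ≤ M` on `A`) and `θ, θ' ≥ θ* > 0`,
`exp{-(m/2)(1/θ - 1/θ')[(μ-ȳ)² - (μ'-ȳ)²]} ≥ exp{-m M²/(2θ*)}`;
consequently, for the posterior `π` of the toy Bayesian normal model with
`B ⊆ [θ*, ∞)`, the cross-ratio `π(μ,θ)π(μ',θ') / [π(μ,θ')π(μ',θ)]` is bounded below by
`ε = exp{-m M²/(2θ*)} > 0` on `A × B`, the condition needed for uniform ergodicity of the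
component-wise independence sampler. -/
theorem toy_CWIS_cross_ratio
    (m : ℕ) (hm : 1 ≤ m) (ybar : ℝ)
    (A : Set ℝ) (M : ℝ) (hM : ∀ μ ∈ A, |μ - ybar| ≤ M)
    (θstar : ℝ) (hθstar : 0 < θstar) :
    (∀ μ ∈ A, ∀ μ' ∈ A, ∀ θ θ' : ℝ, θstar ≤ θ → θstar ≤ θ' →
        Real.exp (-(m : ℝ) * M ^ 2 / (2 * θstar)) ≤
          Real.exp (-((m : ℝ) / 2) * (1 / θ - 1 / θ') *
            ((μ - ybar) ^ 2 - (μ' - ybar) ^ 2))) ∧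
    (∀ (s2 : ℝ), 0 < s2 → ∀ (B : Set ℝ), B ⊆ Set.Ici θstar →
      ∀ (c1 : ℝ), 0 < c1 →
      ∀ μ ∈ A, ∀ μ' ∈ A, ∀ θ ∈ B, ∀ θ' ∈ B,
        Real.exp (-(m : ℝ) * M ^ 2 / (2 * θstar)) *
            (toyPost m ybar s2 A B c1 (μ, θ') * toyPost m ybar s2 A B c1 (μ', θ)) ≤
          toyPost m ybar s2 A B c1 (μ, θ) * toyPost m ybar s2 A B c1 (μ', θ')) := by
  have hexp : ∀ μ ∈ A, ∀ μ' ∈ A, ∀ θ θ' : ℝ, θstar ≤ θ → θstar ≤ θ' →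
      Real.exp (-(m : ℝ) * M ^ 2 / (2 * θstar)) ≤
        Real.exp (-((m : ℝ) / 2) * (1 / θ - 1 / θ') *
          ((μ - ybar) ^ 2 - (μ' - ybar) ^ 2)) :=
    fun μ hμ μ' hμ' θ θ' hθ hθ' => Real.exp_le_exp.2
      (neg_mul_sq_div_le_cross_exponent m.cast_nonneg (hM μ hμ) (hM μ' hμ') hθstar hθ hθ')
  refine ⟨hexp, ?_⟩
  intro s2 _ B hB c1 hc1 μ hμ μ' hμ' θ hθ θ' hθ'
  have hpos : ∀ x ∈ B, 0 < x := fun x hx => hθstar.trans_le (hB hx)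
  have hθpos := hpos θ hθ
  have hθpos' := hpos θ' hθ'
  have hcross : toyPost m ybar s2 A B c1 (μ, θ) * toyPost m ybar s2 A B c1 (μ', θ') =
      Real.exp (-((m : ℝ) / 2) * (1 / θ - 1 / θ') * ((μ - ybar) ^ 2 - (μ' - ybar) ^ 2)) *
        (toyPost m ybar s2 A B c1 (μ, θ') * toyPost m ybar s2 A B c1 (μ', θ)) := by
    have hsum : Real.exp (-(s2 + (m : ℝ) * (μ - ybar) ^ 2) / (2 * θ)) *
          Real.exp (-(s2 + (m : ℝ) * (μ' - ybar) ^ 2) / (2 * θ')) =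
        Real.exp (-((m : ℝ) / 2) * (1 / θ - 1 / θ') * ((μ - ybar) ^ 2 - (μ' - ybar) ^ 2)) *
          (Real.exp (-(s2 + (m : ℝ) * (μ - ybar) ^ 2) / (2 * θ')) *
            Real.exp (-(s2 + (m : ℝ) * (μ' - ybar) ^ 2) / (2 * θ))) := by
      simp only [← Real.exp_add]
      congr 1
      field_simp
      ring
    simp only [toyPost, hμ, hμ', hθ, hθ', and_self, if_true]
    linear_combination
      (c1 ^ 2 * θ ^ (-(((m : ℝ) + 1) / 2)) * θ' ^ (-(((m : ℝ) + 1) / 2))) * hsum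
  have hnonneg : ∀ x ∈ A, ∀ t ∈ B, 0 ≤ toyPost m ybar s2 A B c1 (x, t) := by
    intro x hx t ht
    have := hpos t ht
    simp only [toyPost, hx, ht, and_self, if_true]
    positivity
  rw [hcross]
  exact mul_le_mul_of_nonneg_right (hexp μ hμ μ' hμ' θ θ' (hB hθ) (hB hθ'))
    (mul_nonneg (hnonneg μ hμ θ' hθ') (hnonneg μ' hμ' θ hθ))
end

section
/- Fix an integer q ≥ 1, integers m_i ≥ 1, real numbers β and σ² > 0, covariates x_{ij} ∈ ℝ, and responses y_{ij} ∈ {0, 1} for j = 1, …, m_i, i = 1, …, q; set y_{i+} = Σ_{j=1}^{m_i} y_{ij}. Define ℓ(u) = Σ_{i=1}^q [ u_i y_{i+} − Σ_{j=1}^{m_i} log(1 + e^{β x_{ij} + u_i}) − u_i²/(2σ²) ] for u ∈ ℝ^q, so that the i-th partial derivative of ℓ is y_{i+} − p_{i+}(u) − u_i/σ², where p_{i+}(u) = Σ_{j=1}^{m_i} e^{β x_{ij} + u_i}/(1 + e^{β x_{ij} + u_i}). Then lim_{|u| → ∞} (uᵀ ∇ℓ(u))/|u| = −∞, where |·| is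 the Euclidean norm on ℝ^q. -/
open Filter

/-- A sum of differences between `{0, 1}`-valued responses and logistic success probabilities is
bounded by the number of terms. -/
lemma abs_sum_sub_sum_logistic_le {ι : Type*} [Fintype ι] (y t : ι → ℝ)
    (hy : ∀ j, y j = 0 ∨ y j = 1) :
    |(∑ j, y j) - ∑ j, Real.exp (t j) / (1 + Real.exp (t j))| ≤ Fintype.card ι := by
  rw [← Finset.sum_sub_distrib]
  refine (Finset.abs_sum_le_sum_abs _ _).trans ?_
  have hterm : ∀ j ∈ Finset.univ, |y j - Real.exp (t j) / (1 + Real.exp (t j))| ≤ (1 : ℝ) := by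
    intro j _
    have hexp := Real.exp_pos (t j)
    have hnonneg : 0 ≤ Real.exp (t j) / (1 + Real.exp (t j)) := by positivity
    have hle : Real.exp (t j) / (1 + Real.exp (t j)) ≤ 1 := by
      rw [div_le_one (by positivity)]
      linarith
    rw [abs_le]
    rcases hy j with h | h <;> rw [h] <;> constructor <;> linarith
  simpa using Finset.sum_le_sum hterm

/-- A bounded perturbation of the field `-u / σ2` has radial component at most
`∑ i, c i - ‖u‖ / σ2`. -/
lemma sum_mul_sub_div_norm_le {ι : Type*} [Fintype ι] (c b : ι → ℝ) (σ2 : ℝ)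
    (u : EuclideanSpace ℝ ι) (hb : ∀ i, |b i| ≤ c i) (hu : 0 < ‖u‖) :
    (∑ i, u i * (b i - u i / σ2)) / ‖u‖ ≤ ∑ i, c i - ‖u‖ / σ2 := by
  rw [div_le_iff₀ hu]
  have hterm : ∀ i ∈ Finset.univ, u i * (b i - u i / σ2) ≤ c i * ‖u‖ - u i ^ 2 / σ2 := by
    intro i _
    have hcoord : |u i| ≤ ‖u‖ := PiLp.norm_apply_le u i
    have hprod : u i * b i ≤ c i * ‖u‖ := calc
      u i * b i ≤ |b i| * |u i| := by rw [mul_comm, ← abs_mul]; exact le_abs_self _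
      _ ≤ c i * ‖u‖ := mul_le_mul (hb i) hcoord (abs_nonneg _) ((abs_nonneg _).trans (hb i))
    calc u i * (b i - u i / σ2) = u i * b i - u i ^ 2 / σ2 := by ring
      _ ≤ c i * ‖u‖ - u i ^ 2 / σ2 := by linarith
  calc ∑ i, u i * (b i - u i / σ2) ≤ ∑ i, (c i * ‖u‖ - u i ^ 2 / σ2) := Finset.sum_le_sum hterm
    _ = (∑ i, c i) * ‖u‖ - ‖u‖ ^ 2 / σ2 := by
      rw [Finset.sum_sub_distrib, ← Finset.sum_mul, ← Finset.sum_div,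
        EuclideanSpace.real_norm_sq_eq]
    _ = (∑ i, c i - ‖u‖ / σ2) * ‖u‖ := by ring

/-- First drift condition for geometric ergodicity of the Metropolis random walk in the
logit-normal GLMM: with
`ℓ(u) = Σ_i [u_i y_{i+} - Σ_j log(1 + e^{β x_{ij} + u_i}) - u_i²/(2σ²)]`, whose `i`-th
partial derivative is `y_{i+} - p_{i+}(u) - u_i/σ²`, one has
`u ⬝ ∇ℓ(u) / |u| → -∞` as `|u| → ∞`. -/
theorem glmm_drift_condition_one
    (q : ℕ) (hq : 1 ≤ q) (mi : Fin q → ℕ) (hmi : ∀ i, 1 ≤ mi i)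
    (β σ2 : ℝ) (hσ2 : 0 < σ2)
    (x : ∀ i : Fin q, Fin (mi i) → ℝ)
    (y : ∀ i : Fin q, Fin (mi i) → ℝ) (hy : ∀ i j, y i j = 0 ∨ y i j = 1) :
    Tendsto
      (fun u : EuclideanSpace ℝ (Fin q) =>
        (∑ i, u i * ((∑ j, y i j) -
          (∑ j, Real.exp (β * x i j + u i) / (1 + Real.exp (β * x i j + u i))) -
          u i / σ2)) / ‖u‖)
      (comap norm atTop) atBot := by
  have hnorm : Tendsto (norm : EuclideanSpace ℝ (Fin q) → ℝ) (comap norm atTop) atTop :=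
    tendsto_comap
  have hbound : Tendsto (fun u : EuclideanSpace ℝ (Fin q) => ∑ i, (mi i : ℝ) - ‖u‖ / σ2)
      (comap norm atTop) atBot := by
    simp only [sub_eq_add_neg]
    exact tendsto_atBot_add_const_left _ _
      (tendsto_neg_atTop_atBot.comp (hnorm.atTop_div_const hσ2))
  refine tendsto_atBot_mono' _ ?_ hbound
  filter_upwards [hnorm.eventually_gt_atTop 0] with u hu
  refine sum_mul_sub_div_norm_le _ _ σ2 u (fun i => ?_) hu
  simpa using abs_sum_sub_sum_logistic_le (y i) (fun j => β * x i j + u i) (hy i)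
end

section
/- Fix an integer q ≥ 1, integers m_i ≥ 1, real numbers β and σ² > 0, covariates x_{ij} ∈ ℝ, and responses y_{ij} ∈ {0, 1} for j = 1, …, m_i, i = 1, …, q; set y_{i+} = Σ_{j=1}^{m_i} y_{ij}. Define ℓ(u) = Σ_{i=1}^q [ u_i y_{i+} − Σ_{j=1}^{m_i} log(1 + e^{β x_{ij} + u_i}) − u_i²/(2σ²) ] for u ∈ ℝ^q, with i-th partial derivative y_{i+} − p_{i+}(u) − u_i/σ², where p_{i+}(u) = Σ_{j=1}^{m_i} e^{β x_{ij} + u_i}/(1 + e^{β x_{ij} + u_i}). Then lim sup_{|u| → ∞} (uᵀ ∇ℓ(u))/( |u| · |∇ℓ(u)| ) = −1; in particular this lim sup is strictly negative. -/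
open Filter

/-- A bounded perturbation of the linear field `-c • u` asymptotically points in the direction
opposite to `u`. -/
theorem tendsto_inner_div_norm_mul_norm_of_bounded_add_smul
    {E : Type*} [NormedAddCommGroup E] [InnerProductSpace ℝ E]
    {G : E → E} {c C : ℝ} (hc : 0 < c) (hG : ∀ u, ‖G u + c • u‖ ≤ C) :
    Tendsto (fun u => inner ℝ u (G u) / (‖u‖ * ‖G u‖)) (comap norm atTop) (nhds (-1)) := by
  have hC : 0 ≤ C := (norm_nonneg _).trans (hG 0)
  have hlim : Tendsto (fun r : ℝ => -1 + 2 * C / (C + c * r)) atTop (nhds (-1)) := by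
    have h : Tendsto (fun r : ℝ => C + c * r) atTop atTop :=
      tendsto_atTop_add_const_left _ _ (tendsto_id.const_mul_atTop hc)
    simpa using (h.const_div_atTop (2 * C)).const_add (-1)
  refine tendsto_of_tendsto_of_tendsto_of_le_of_le' tendsto_const_nhds
    (hlim.comp tendsto_comap) (Eventually.of_forall fun u => ?_) ?_
  · exact (abs_le.mp (abs_real_inner_div_norm_mul_norm_le_one u (G u))).1
  · have hev : ∀ᶠ u : E in comap norm atTop, C / c < ‖u‖ :=
      tendsto_comap.eventually (eventually_gt_atTop (C / c))
    filter_upwards [hev] with u hu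
    have hu0 : 0 < ‖u‖ := (div_nonneg hC hc.le).trans_lt hu
    have hCu : C < c * ‖u‖ := by rwa [div_lt_iff₀' hc] at hu
    have hcu : ‖c • u‖ = c * ‖u‖ := by rw [norm_smul, Real.norm_of_nonneg hc.le]
    have hGle : ‖G u‖ ≤ C + c * ‖u‖ := by
      have h := norm_sub_le (G u + c • u) (c • u)
      rw [add_sub_cancel_right, hcu] at h
      linarith [hG u]
    have hGpos : 0 < ‖G u‖ := by
      have h := norm_sub_le (G u + c • u) (G u)
      rw [add_sub_cancel_left, hcu] at h
      linarith [hG u]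
    have hinner : inner ℝ u (G u) ≤ ‖u‖ * (C - c * ‖u‖) := by
      have h := real_inner_le_norm u (G u + c • u)
      rw [inner_add_right, real_inner_smul_right, real_inner_self_eq_norm_sq] at h
      nlinarith [mul_le_mul_of_nonneg_left (hG u) hu0.le]
    have hsum : 0 < C + c * ‖u‖ := hGpos.trans_le hGle
    have heq : -1 + 2 * C / (C + c * ‖u‖) = (C - c * ‖u‖) / (C + c * ‖u‖) := by
      field_simp
      ring
    simp only [Function.comp_apply]
    rw [heq, div_le_div_iff₀ (mul_pos hu0 hGpos) hsum]
    calc inner ℝ u (G u) * (C + c * ‖u‖)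
        ≤ ‖u‖ * (C - c * ‖u‖) * (C + c * ‖u‖) := mul_le_mul_of_nonneg_right hinner hsum.le
      _ ≤ ‖u‖ * (C - c * ‖u‖) * ‖G u‖ :=
          mul_le_mul_of_nonpos_left hGle
            (mul_nonpos_of_nonneg_of_nonpos hu0.le (by linarith))
      _ = (C - c * ‖u‖) * (‖u‖ * ‖G u‖) := by ring

/-- Sums of `[0, 1]`-valued families differ by at most the size of the index type. -/
theorem abs_sum_sub_sum_le_card {ι : Type*} [Fintype ι] {f g : ι → ℝ}
    (hf : ∀ j, f j ∈ Set.Icc 0 1) (hg : ∀ j, g j ∈ Set.Icc 0 1) :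
    |∑ j, f j - ∑ j, g j| ≤ Fintype.card ι := by
  rw [← Finset.sum_sub_distrib]
  calc |∑ j, (f j - g j)| ≤ ∑ j, |f j - g j| := Finset.abs_sum_le_sum_abs _ _
    _ ≤ ∑ _j : ι, (1 : ℝ) := Finset.sum_le_sum fun j _ => by
        obtain ⟨hf0, hf1⟩ := hf j
        obtain ⟨hg0, hg1⟩ := hg j
        exact abs_le.mpr ⟨by linarith, by linarith⟩
    _ = Fintype.card ι := by simp

/-- Second drift condition for geometric ergodicity of the Metropolis random walk in the
logit-normal GLMM: with
`ℓ(u) = Σ_i [u_i y_{i+} - Σ_j log(1 + e^{β x_{ij} + u_i}) - u_i²/(2σ²)]`, whose gradient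
has `i`-th component `y_{i+} - p_{i+}(u) - u_i/σ²`, one has
`limsup_{|u| → ∞} u ⬝ ∇ℓ(u) / (|u| |∇ℓ(u)|) = -1 < 0`. -/
theorem glmm_drift_condition_two
    (q : ℕ) (hq : 1 ≤ q) (mi : Fin q → ℕ) (hmi : ∀ i, 1 ≤ mi i)
    (β σ2 : ℝ) (hσ2 : 0 < σ2)
    (x : ∀ i : Fin q, Fin (mi i) → ℝ)
    (y : ∀ i : Fin q, Fin (mi i) → ℝ) (hy : ∀ i j, y i j = 0 ∨ y i j = 1)
    -- `G u` is the gradient `∇ℓ(u)` as a vector in Euclidean space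
    (G : EuclideanSpace ℝ (Fin q) → EuclideanSpace ℝ (Fin q))
    (hG : ∀ u i, G u i = (∑ j, y i j) -
      (∑ j, Real.exp (β * x i j + u i) / (1 + Real.exp (β * x i j + u i))) - u i / σ2) :
    limsup
      (fun u : EuclideanSpace ℝ (Fin q) =>
        (∑ i, u i * G u i) / (‖u‖ * ‖G u‖))
      (comap norm atTop) = -1 ∧
    limsup
      (fun u : EuclideanSpace ℝ (Fin q) =>
        (∑ i, u i * G u i) / (‖u‖ * ‖G u‖))
      (comap norm atTop) < 0 := by
  have hbound : ∀ u, ‖G u + σ2⁻¹ • u‖ ≤ √(∑ i, (mi i : ℝ) ^ 2) := fun u => by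
    rw [EuclideanSpace.norm_eq]
    refine Real.sqrt_le_sqrt (Finset.sum_le_sum fun i _ => ?_)
    refine pow_le_pow_left₀ (norm_nonneg _) ?_ 2
    have hcoord : (G u + σ2⁻¹ • u) i = (∑ j, y i j) -
        ∑ j, Real.exp (β * x i j + u i) / (1 + Real.exp (β * x i j + u i)) := by
      rw [PiLp.add_apply, PiLp.smul_apply, hG, smul_eq_mul]
      ring
    rw [hcoord, Real.norm_eq_abs]
    refine (abs_sum_sub_sum_le_card (fun j => ?_) fun j => ⟨by positivity, ?_⟩).trans_eq (by simp)
    · rcases hy i j with h | h <;> simp [h]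
    · exact div_le_one_of_le₀ (by linarith) (by positivity)
  have htendsto := tendsto_inner_div_norm_mul_norm_of_bounded_add_smul (inv_pos.mpr hσ2) hbound
  have : Nonempty (Fin q) := ⟨⟨0, hq⟩⟩
  have : (comap (norm : EuclideanSpace ℝ (Fin q) → ℝ) atTop).NeBot := by
    rw [comap_norm_atTop]
    infer_instance
  have hlimsup : limsup (fun u : EuclideanSpace ℝ (Fin q) =>
      (∑ i, u i * G u i) / (‖u‖ * ‖G u‖)) (comap norm atTop) = -1 := by
    rw [← htendsto.limsup_eq]
    simp [PiLp.inner_apply, mul_comm]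
  exact ⟨hlimsup, hlimsup.trans_lt (by norm_num)⟩
end
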